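/- Fix integers m>0, n>0 and define F(x,y):=(m+x)/√((m+x)²+(n+y)²) + x/√(x²+y²) − m/√(m²+n²) for (x,y)∈ℝ² with (x,y)≠(0,0) and (x,y)≠(−m,−n). (a) If 2m>√(m²+n²) (equivalently 3m²>n²), then there exists a unique x∈ℝ∖{−m} with F(x,−n)=0, and this x satisfies x>−m. (b) If 2m<√(m²+n²) (equivalently n²>3m²), then there is no x∈ℝ∖{−m} with F(x,−n)=0. -/

import Mathlib

/-- The function whose zero set characterizes the resonant set `R_k` away from `0` and `-k`. -/
noncomputable def Ffun (m n : ℤ) (x y : ℝ) : ℝ :=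
  ((m : ℝ) + x) / Real.sqrt (((m : ℝ) + x) ^ 2 + ((n : ℝ) + y) ^ 2)
    + x / Real.sqrt (x ^ 2 + y ^ 2)
    - (m : ℝ) / Real.sqrt ((m : ℝ) ^ 2 + (n : ℝ) ^ 2)

theorem g_eq (n x : ℝ) (hn : 0 < n) :
    x / Real.sqrt (x ^ 2 + n ^ 2) = Real.sin (Real.arctan (x / n)) := by
  rw [Real.sin_arctan]
  have h : x ^ 2 + n ^ 2 = (1 + (x / n) ^ 2) * n ^ 2 := by field_simp; ring
  rw [h, Real.sqrt_mul (by positivity), Real.sqrt_sq hn.le]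
  field_simp

theorem g_mono (n : ℝ) (hn : 0 < n) :
    StrictMono (fun x : ℝ => x / Real.sqrt (x ^ 2 + n ^ 2)) := by
  intro x y hxy
  simp only [g_eq n _ hn]
  apply Real.strictMonoOn_sin
  · exact ⟨(Real.neg_pi_div_two_lt_arctan _).le, (Real.arctan_lt_pi_div_two _).le⟩
  · exact ⟨(Real.neg_pi_div_two_lt_arctan _).le, (Real.arctan_lt_pi_div_two _).le⟩
  · exact Real.arctan_strictMono (div_lt_div_of_pos_right hxy hn)

theorem g_surj (n d : ℝ) (hn : 0 < n) (h1 : -1 < d) (h2 : d < 1) :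
    ∃ x : ℝ, x / Real.sqrt (x ^ 2 + n ^ 2) = d := by
  refine ⟨n * Real.tan (Real.arcsin d), ?_⟩
  rw [g_eq n _ hn, mul_div_cancel_left₀ _ hn.ne', Real.arctan_tan, Real.sin_arcsin h1.le h2.le]
  · exact Real.neg_pi_div_two_lt_arcsin.2 h1
  · exact Real.arcsin_lt_pi_div_two.2 h2

theorem g_lt_one (n x : ℝ) (hn : 0 < n) : x / Real.sqrt (x ^ 2 + n ^ 2) < 1 := by
  rw [div_lt_one (by positivity)]
  apply Real.lt_sqrt_of_sq_lt
  nlinarith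

theorem F_pos (m n : ℤ) (x : ℝ) (hx : -(m : ℝ) < x) : Ffun m n x (-(n : ℝ)) =
    1 + x / Real.sqrt (x ^ 2 + (n : ℝ) ^ 2) - m / Real.sqrt ((m : ℝ) ^ 2 + (n : ℝ) ^ 2) := by
  have h : (0 : ℝ) < m + x := by linarith
  simp [Ffun, Real.sqrt_sq h.le, h.ne']

theorem F_neg (m n : ℤ) (x : ℝ) (hx : x < -(m : ℝ)) : Ffun m n x (-(n : ℝ)) =
    -1 + x / Real.sqrt (x ^ 2 + (n : ℝ) ^ 2) - m / Real.sqrt ((m : ℝ) ^ 2 + (n : ℝ) ^ 2) := by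
  have h : (m : ℝ) + x < 0 := by linarith
  simp [Ffun, Real.sqrt_sq_eq_abs, abs_of_neg h]
  rw [div_eq_iff (by linarith)]; ring

/-- on the horizontal line `y = -n`, (a) if `2m > ‖k‖` there is a unique
`x ≠ -m` with `F(x,-n) = 0`, and it satisfies `x > -m`; (b) if `2m < ‖k‖` there is no
`x ≠ -m` with `F(x,-n) = 0`. -/
theorem resonant_at_minus_n (m n : ℤ) (hm : 0 < m) (hn : 0 < n) :
    ((Real.sqrt ((m : ℝ) ^ 2 + (n : ℝ) ^ 2) < 2 * (m : ℝ)) →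
      ((∃! x : ℝ, x ≠ -(m : ℝ) ∧ Ffun m n x (-(n : ℝ)) = 0) ∧
        (∀ x : ℝ, x ≠ -(m : ℝ) → Ffun m n x (-(n : ℝ)) = 0 → -(m : ℝ) < x))) ∧
    ((2 * (m : ℝ) < Real.sqrt ((m : ℝ) ^ 2 + (n : ℝ) ^ 2)) →
      ∀ x : ℝ, x ≠ -(m : ℝ) → Ffun m n x (-(n : ℝ)) ≠ 0) := by
  have hm' : (0 : ℝ) < m := by exact_mod_cast hm
  have hn' : (0 : ℝ) < n := by exact_mod_cast hn
  have hmono := g_mono n hn'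
  have hK : 0 < Real.sqrt ((m : ℝ) ^ 2 + (n : ℝ) ^ 2) := by positivity
  have hc : 0 < (m : ℝ) / Real.sqrt ((m : ℝ) ^ 2 + (n : ℝ) ^ 2) := by positivity
  have hc1 := g_lt_one n m hn'
  have hgneg : (-(m : ℝ)) / Real.sqrt ((-(m : ℝ)) ^ 2 + (n : ℝ) ^ 2)
      = -((m : ℝ) / Real.sqrt ((m : ℝ) ^ 2 + (n : ℝ) ^ 2)) := by
    rw [neg_sq, neg_div]
  have key : ∀ x : ℝ, x ≠ -(m : ℝ) → Ffun m n x (-(n : ℝ)) = 0 → -(m : ℝ) < x := by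
    intro x hx hF
    rcases lt_or_gt_of_ne hx with h | h
    · rw [F_neg m n x h] at hF
      have := g_lt_one n x hn'
      linarith
    · exact h
  refine ⟨fun h => ⟨?_, key⟩, fun h x hx hF => ?_⟩
  · have h2 : 1 / 2 < (m : ℝ) / Real.sqrt ((m : ℝ) ^ 2 + (n : ℝ) ^ 2) := by
      rw [lt_div_iff₀ hK]; linarith
    obtain ⟨x, hx⟩ := g_surj n ((m : ℝ) / Real.sqrt ((m : ℝ) ^ 2 + (n : ℝ) ^ 2) - 1) hn'
      (by linarith) (by linarith)
    have hxm : -(m : ℝ) < x := by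
      apply hmono.lt_iff_lt.1
      try simp only
      rw [hgneg, hx]
      linarith
    refine ⟨x, ⟨hxm.ne', ?_⟩, ?_⟩
    · rw [F_pos m n x hxm, hx]; ring
    · rintro y ⟨hy, hF⟩
      rw [F_pos m n y (key y hy hF)] at hF
      apply hmono.injective
      simp only
      linarith
  · have h2 : (m : ℝ) / Real.sqrt ((m : ℝ) ^ 2 + (n : ℝ) ^ 2) < 1 / 2 := by
      rw [div_lt_iff₀ hK]; linarith
    have hxm := key x hx hF
    rw [F_pos m n x hxm] at hF
    have h3 := hmono hxm
    simp only at h3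
    rw [hgneg] at h3
    linarith
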